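/- arXiv:1710.07719 — 2 statements merged into one kernel-verified Lean document; each statement's English description precedes it below -/
import Mathlib

section
/- Let M = Σ_{j∈[m]} √(f_j (1 − f_j)). Then for all integers 0 ≤ k ≤ n and all j ∈ [m], |E[min{Z_j^n, (k − Σ_{i∈[j−1]} Z_i^n)_+}] − min{n f_j, (k − Σ_{i∈[j−1]} n f_i)_+}| ≤ M √n; in particular, |E[𝔖_j^n] − s_j^*| ≤ M √n for all j ∈ [m]. -/
open MeasureTheory ProbabilityTheory Finset

noncomputable section

namespace MultiSecretary

variable {Ω : Type*}

/-- `Z_j^r`: the number of candidates with ability `aj` among the first `r`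
(candidates are indexed `0, 1, …`, so `X 0, …, X (r-1)` are the first `r`). -/
def Zc (X : ℕ → Ω → ℝ) (aj : ℝ) (r : ℕ) (ω : Ω) : ℝ :=
  ∑ t ∈ range r, if X t ω = aj then 1 else 0

/-- `F̄(a_j) = f_1 + ⋯ + f_{j-1}`. -/
def Fbar (f : ℕ → ℝ) (j : ℕ) : ℝ := ∑ i ∈ Icc 1 (j - 1), f i

/-- The offline-sort count `𝔖_j^r = min { Z_j^r , (k - ∑_{i<j} Z_i^r)_+ }`. -/
def Soff (a : ℕ → ℝ) (X : ℕ → Ω → ℝ) (k r j : ℕ) (ω : Ω) : ℝ :=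
  min (Zc X (a j) r ω) (max ((k : ℝ) - ∑ i ∈ Icc 1 (j - 1), Zc X (a i) r ω) 0)

/-- The offline value `V_off^*(n,k) = ∑_j a_j E[𝔖_j^n]`. -/
def Voff [MeasurableSpace Ω] (μ : Measure Ω) (m : ℕ) (a : ℕ → ℝ) (X : ℕ → Ω → ℝ)
    (n k : ℕ) : ℝ :=
  ∑ j ∈ Icc 1 m, a j * ∫ ω, Soff a X k n j ω ∂μ

/-- The σ-field `𝓕_t` generated by the first `t` pairs `(X_s, U_s)`. -/
def Fil (X U : ℕ → Ω → ℝ) (t : ℕ) : MeasurableSpace Ω :=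
  MeasurableSpace.comap (fun ω => fun s : Fin t => (X s ω, U s ω)) inferInstance

/-- A feasible online policy for the `(n,k)` multi-secretary problem: `σp t` is the
(0/1-valued) decision about candidate `t` (0-indexed), measurable with respect to
`𝓕_{t+1} = σ(X_0,U_0,…,X_t,U_t)`, and at most `k` candidates are selected. -/
def IsPolicy (X U : ℕ → Ω → ℝ) (n k : ℕ) (σp : ℕ → Ω → ℕ) : Prop :=
  (∀ t ω, σp t ω ≤ 1) ∧
  (∀ t, Measurable[Fil X U (t + 1)] (σp t)) ∧
  (∀ ω, ∑ t ∈ range n, σp t ω ≤ k)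

/-- The value `V_on^π(n,k)` of an online policy. -/
def Von [MeasurableSpace Ω] (μ : Measure Ω) (X : ℕ → Ω → ℝ) (n : ℕ) (σp : ℕ → Ω → ℕ) : ℝ :=
  ∫ ω, (∑ t ∈ range n, X t ω * (σp t ω : ℝ)) ∂μ

/-- `V_on^*(n,k)`, the optimal value over feasible online policies. -/
def VonStar [MeasurableSpace Ω] (μ : Measure Ω) (X U : ℕ → Ω → ℝ) (n k : ℕ) : ℝ :=
  sSup {v : ℝ | ∃ σp, IsPolicy X U n k σp ∧ v = Von μ X n σp}

/-- `S_j^{π,r}`: the number of `a_j`-candidates selected by policy `π` among the first `r`. -/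
def Spol (a : ℕ → ℝ) (X : ℕ → Ω → ℝ) (σp : ℕ → Ω → ℕ) (j r : ℕ) (ω : Ω) : ℝ :=
  ∑ t ∈ range r, (σp t ω : ℝ) * (if X t ω = a j then 1 else 0)

/-- The Budget-Ratio thresholds: `T_1 = 0`, `T_j = (F̄(a_j)+F̄(a_{j+1}))/2` for `j ≥ 2`. -/
def Tthr (f : ℕ → ℝ) (j : ℕ) : ℝ := if j = 1 then 0 else (Fbar f j + Fbar f (j + 1)) / 2

/-- The index `j ∈ [m]` with `T_j ≤ x < T_{j+1}` (with `T_{m+1} = ∞`), i.e. the largest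
`j ∈ [m]` with `T_j ≤ x`. -/
def jBR (m : ℕ) (f : ℕ → ℝ) (x : ℝ) : ℕ :=
  ((Icc 1 m).filter fun j => Tthr f j ≤ x).sup id

/-- The remaining-budget process `K_t` of the Budget-Ratio policy: `K_0 = k`, and the
candidate `X_t` (presented at time `t+1`, 1-indexed) is selected iff `K_t > 0` and
`X_t > a_{j+1}` where `T_j ≤ K_t/(n-t) < T_{j+1}` (for `j = m`, i.e. `T_m ≤ K_t/(n-t)`,
every candidate is selected since `T_{m+1} = ∞` and `a_{m+1} < a_m`). -/
def Kbr (m : ℕ) (a f : ℕ → ℝ) (X : ℕ → Ω → ℝ) (n k : ℕ) : ℕ → Ω → ℕ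
  | 0, _ => k
  | t + 1, ω =>
    Kbr m a f X n k t ω -
      (if 0 < Kbr m a f X n k t ω ∧
          (jBR m f ((Kbr m a f X n k t ω : ℝ) / ((n : ℝ) - t)) = m ∨
            a (jBR m f ((Kbr m a f X n k t ω : ℝ) / ((n : ℝ) - t)) + 1) < X t ω)
        then 1 else 0)

/-- The selection decisions `σ^br` of the Budget-Ratio policy (0-indexed candidates). -/
def σbr (m : ℕ) (a f : ℕ → ℝ) (X : ℕ → Ω → ℝ) (n k : ℕ) (t : ℕ) (ω : Ω) : ℕ :=
  Kbr m a f X n k t ω - Kbr m a f X n k (t + 1) ω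

/-- The Bernoulli selection indicators `B_t` of a non-adaptive policy `p = (p_{j,t})`. -/
def Bna (m : ℕ) (a : ℕ → ℝ) (p : ℕ → ℕ → ℝ) (X U : ℕ → Ω → ℝ) (t : ℕ) (ω : Ω) : ℝ :=
  ∑ j ∈ Icc 1 m, if U t ω ≤ p j t ∧ X t ω = a j then 1 else 0

/-- The stopping time `ν = min{ r ≥ 1 : B_1 + ⋯ + B_r ≥ k or r ≥ n }` of a
non-adaptive policy. -/
def nuNA (m : ℕ) (a : ℕ → ℝ) (p : ℕ → ℕ → ℝ) (X U : ℕ → Ω → ℝ) (n k : ℕ) (ω : Ω) : ℕ :=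
  sInf {r : ℕ | 1 ≤ r ∧ ((k : ℝ) ≤ ∑ t ∈ range r, Bna m a p X U t ω ∨ n ≤ r)}

/-- The value `V_on^π(n,k) = ∑_j a_j E[∑_{t ≤ ν} B_t 1(X_t = a_j)]` of a non-adaptive policy. -/
def VonNA [MeasurableSpace Ω] (μ : Measure Ω) (m : ℕ) (a : ℕ → ℝ) (p : ℕ → ℕ → ℝ)
    (X U : ℕ → Ω → ℝ) (n k : ℕ) : ℝ :=
  ∑ j ∈ Icc 1 m, a j *
    ∫ ω, (∑ t ∈ range (nuNA m a p X U n k ω), if X t ω = a j then Bna m a p X U t ω else 0) ∂μ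

/-- `V_na^*(n,k)`: the optimal value over non-adaptive policies. -/
def VnaStar [MeasurableSpace Ω] (μ : Measure Ω) (m : ℕ) (a : ℕ → ℝ) (X U : ℕ → Ω → ℝ)
    (n k : ℕ) : ℝ :=
  sSup {v : ℝ | ∃ p : ℕ → ℕ → ℝ,
    (∀ j t, 0 ≤ p j t ∧ p j t ≤ 1) ∧ v = VonNA μ m a p X U n k}

/-- The deterministic relaxation `DR(n,k)`. -/
def DRval (m : ℕ) (a f : ℕ → ℝ) (n k : ℕ) : ℝ :=
  sSup {v : ℝ | ∃ s : ℕ → ℝ,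
    (∀ j ∈ Icc 1 m, 0 ≤ s j ∧ s j ≤ (n : ℝ) * f j) ∧
    (∑ j ∈ Icc 1 m, s j) ≤ (k : ℝ) ∧ v = ∑ j ∈ Icc 1 m, a j * s j}

/-- The optimal solution `s_j^* = min{ n f_j, (k - n F̄(a_j))_+ }` of the deterministic
relaxation. -/
def sStar (f : ℕ → ℝ) (n k j : ℕ) : ℝ :=
  min ((n : ℝ) * f j) (max ((k : ℝ) - (n : ℝ) * Fbar f j) 0)

/-- `J0Spec m f n k j` says that `j = j₀(n,k)`, the action index of `(n,k)`. -/
def J0Spec (m : ℕ) (f : ℕ → ℝ) (n k j : ℕ) : Prop :=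
  (j = 1 ∧ (k : ℝ) / (n : ℝ) < f 1 + f 2 / 2) ∨
  (1 ≤ j ∧ j + 1 ≤ m ∧ Fbar f j + f j / 2 ≤ (k : ℝ) / (n : ℝ) ∧
    (k : ℝ) / (n : ℝ) < Fbar f (j + 2) - f (j + 1) / 2) ∨
  (j = m ∧ 1 - f m / 2 ≤ (k : ℝ) / (n : ℝ))

/-- The budget ratio `K_t / (n - t)`. -/
def ratio (K : ℕ → Ω → ℕ) (n t : ℕ) (ω : Ω) : ℝ := (K t ω : ℝ) / ((n : ℝ) - t)

/-- The time `τ₀` at which the budget ratio first enters the `δ/2`-orbit of a threshold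
(or the deterministic time `n - 2δ⁻¹ - 1` is reached). -/
def tau0 (m : ℕ) (f : ℕ → ℝ) (δ : ℝ) (K : ℕ → Ω → ℕ) (n : ℕ) (ω : Ω) : ℕ :=
  sInf {t : ℕ |
    (∃ j ∈ Icc 1 m, |ratio K n t ω - Tthr f j| ≤ δ / 2) ∨ (n : ℝ) - 2 / δ - 1 ≤ (t : ℝ)}

/-- The index `j(τ₀)` of the threshold entered at time `τ₀` (set to `m+1`, corresponding to
`T_{j(τ₀)} = ∞`, when `τ₀ ≥ n - 2δ⁻¹ - 1`). -/
def jTau0 (m : ℕ) (f : ℕ → ℝ) (δ : ℝ) (K : ℕ → Ω → ℕ) (n : ℕ) (ω : Ω) : ℕ :=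
  if (tau0 m f δ K n ω : ℝ) < (n : ℝ) - 2 / δ - 1 then
    sInf {j : ℕ | j ∈ Icc 1 m ∧ |ratio K n (tau0 m f δ K n ω) ω - Tthr f j| ≤ δ / 2}
  else m + 1

/-- The exit time `τ = inf{ t > τ₀ : |K_t/(n-t) - T_{j(τ₀)}| > δ or t ≥ n - 2δ⁻¹ - 1 }`
(for `j(τ₀) = m + 1`, i.e. `T_{j(τ₀)} = ∞`, the first condition is vacuous). -/
def tauBR (m : ℕ) (f : ℕ → ℝ) (δ : ℝ) (K : ℕ → Ω → ℕ) (n : ℕ) (ω : Ω) : ℕ :=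
  sInf {t : ℕ | tau0 m f δ K n ω < t ∧
    ((n : ℝ) - 2 / δ - 1 ≤ (t : ℝ) ∨
      (jTau0 m f δ K n ω ≤ m ∧ δ < |ratio K n t ω - Tthr f (jTau0 m f δ K n ω)|))}

/-- The deviation process `Y_u = K_{τ₀+u} - T_{j(τ₀)} (n - τ₀ - u)`. -/
def Ydev (m : ℕ) (f : ℕ → ℝ) (δ : ℝ) (K : ℕ → Ω → ℕ) (n : ℕ) (u : ℕ) (ω : Ω) : ℝ :=
  (K (tau0 m f δ K n ω + u) ω : ℝ) -
    Tthr f (jTau0 m f δ K n ω) * ((n : ℝ) - (tau0 m f δ K n ω : ℝ) - (u : ℝ))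

/-- The minimal mass `min{f_1, …, f_m}` of the ability distribution. -/
def minf (m : ℕ) (f : ℕ → ℝ) : ℝ := sInf {x : ℝ | ∃ j, 1 ≤ j ∧ j ≤ m ∧ x = f j}

/-- The standing model hypotheses of the multi-secretary problem: the abilities
`0 < a_m < ⋯ < a_1`, the probability mass function `f`, and the i.i.d. sequence of
abilities `X_t` together with the auxiliary i.i.d. uniform randomization variables `U_t`. -/
structure Model [MeasurableSpace Ω] (μ : Measure Ω) (m : ℕ) (a f : ℕ → ℝ)
    (X U : ℕ → Ω → ℝ) : Prop where
  hm : 1 ≤ m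
  ha_anti : ∀ j, 1 ≤ j → j < m → a (j + 1) < a j
  ha_pos : 0 < a m
  hf_pos : ∀ j, 1 ≤ j → j ≤ m → 0 < f j
  hf_sum : ∑ j ∈ Icc 1 m, f j = 1
  hprob : IsProbabilityMeasure μ
  hXmeas : ∀ t, Measurable (X t)
  hUmeas : ∀ t, Measurable (U t)
  hXdist : ∀ t j, 1 ≤ j → j ≤ m → μ {ω | X t ω = a j} = ENNReal.ofReal (f j)
  hUdist : ∀ t, μ.map (U t) = volume.restrict (Set.Icc (0 : ℝ) 1)
  hIndep : iIndepFun (fun t ω => (X t ω, U t ω)) μ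
  hXUIndep : ∀ t, IndepFun (X t) (U t) μ

/-- The standing model hypotheses with only the ability sequence `X` (no auxiliary
randomization). -/
structure ModelX [MeasurableSpace Ω] (μ : Measure Ω) (m : ℕ) (a f : ℕ → ℝ)
    (X : ℕ → Ω → ℝ) : Prop where
  hm : 1 ≤ m
  ha_anti : ∀ j, 1 ≤ j → j < m → a (j + 1) < a j
  ha_pos : 0 < a m
  hf_pos : ∀ j, 1 ≤ j → j ≤ m → 0 < f j
  hf_sum : ∑ j ∈ Icc 1 m, f j = 1
  hprob : IsProbabilityMeasure μ
  hXmeas : ∀ t, Measurable (X t)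
  hXdist : ∀ t j, 1 ≤ j → j ≤ m → μ {ω | X t ω = a j} = ENNReal.ofReal (f j)
  hIndep : iIndepFun X μ


lemma Zc_measurable [MeasurableSpace Ω] (X : ℕ → Ω → ℝ) (hX : ∀ t, Measurable (X t)) (c : ℝ)
    (n : ℕ) : Measurable (Zc X c n) := by
  unfold Zc
  refine Finset.measurable_fun_sum _ fun t _ => ?_
  exact Measurable.ite (hX t (measurableSet_singleton c)) measurable_const measurable_const

lemma Zc_nonneg (X : ℕ → Ω → ℝ) (c : ℝ) (n : ℕ) (ω : Ω) : 0 ≤ Zc X c n ω := by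
  unfold Zc
  refine Finset.sum_nonneg fun t _ => ?_
  split_ifs <;> norm_num

lemma Zc_le (X : ℕ → Ω → ℝ) (c : ℝ) (n : ℕ) (ω : Ω) : Zc X c n ω ≤ n := by
  unfold Zc
  calc _ ≤ ∑ t ∈ range n, (1 : ℝ) := by
        refine Finset.sum_le_sum fun t _ => ?_
        split_ifs <;> norm_num
    _ = n := by simp

lemma Zc_memLp [MeasurableSpace Ω] (μ : Measure Ω) [IsProbabilityMeasure μ]
    (X : ℕ → Ω → ℝ) (hX : ∀ t, Measurable (X t)) (c : ℝ) (n : ℕ) : MemLp (Zc X c n) 2 μ := by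
  refine MemLp.of_bound (Zc_measurable X hX c n).aestronglyMeasurable (n : ℝ) ?_
  refine Filter.Eventually.of_forall fun ω => ?_
  rw [Real.norm_eq_abs, abs_of_nonneg (Zc_nonneg X c n ω)]
  exact Zc_le X c n ω

lemma Zc_dev [MeasurableSpace Ω] (μ : Measure Ω) [IsProbabilityMeasure μ]
    (X : ℕ → Ω → ℝ) (hX : ∀ t, Measurable (X t)) (hI : iIndepFun X μ) (c p : ℝ) (hp : 0 ≤ p)
    (hd : ∀ t, μ {ω | X t ω = c} = ENNReal.ofReal p) (n : ℕ) :
    ∫ ω, |Zc X c n ω - n * p| ∂μ ≤ Real.sqrt (p * (1 - p)) * Real.sqrt n := by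
  let g : ℝ → ℝ := fun x => if x = c then 1 else 0
  have hg : Measurable g :=
    Measurable.ite (measurableSet_singleton c) measurable_const measurable_const
  let Y : ℕ → Ω → ℝ := fun t ω => g (X t ω)
  have hYm : ∀ t, Measurable (Y t) := fun t => hg.comp (hX t)
  have hY2 : ∀ t, MemLp (Y t) 2 μ := fun t => by
    refine MemLp.of_bound (hYm t).aestronglyMeasurable 1 ?_
    refine Filter.Eventually.of_forall fun ω => ?_
    simp only [Y, g]
    split_ifs <;> norm_num
  have hYI : iIndepFun Y μ := hI.comp (fun _ => g) (fun _ => hg)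
  have hYint : ∀ t, ∫ ω, Y t ω ∂μ = p := fun t => by
    have h1 : Y t = Set.indicator {ω | X t ω = c} (fun _ => (1 : ℝ)) := by
      funext ω
      simp [Y, g, Set.indicator]
    rw [h1, integral_indicator_const (1 : ℝ)
      (show MeasurableSet {ω | X t ω = c} from hX t (measurableSet_singleton c))]
    simp [Measure.real, hd t, hp]
  have hYvar : ∀ t, variance (Y t) μ = p * (1 - p) := fun t => by
    rw [variance_eq_sub (hY2 t)]
    have h2 : (Y t) ^ 2 = Y t := by
      funext ω
      simp only [Y, g, Pi.pow_apply]
      split_ifs <;> norm_num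
    rw [h2, hYint t]
    ring
  have hZ : Zc X c n = ∑ t ∈ range n, Y t := by
    funext ω
    simp [Zc, Y, g]
  have hZvar : variance (Zc X c n) μ = n * (p * (1 - p)) := by
    rw [hZ, IndepFun.variance_sum (fun t _ => hY2 t) (fun i _ j _ hij => hYI.indepFun hij)]
    simp [hYvar]
  have hZint : ∫ ω, Zc X c n ω ∂μ = n * p := by
    rw [hZ]
    simp only [Finset.sum_apply]
    rw [integral_finsetSum _ (fun t _ => (hY2 t).integrable (by norm_num))]
    simp [hYint]
  have hW : MemLp (fun ω => Zc X c n ω - n * p) 2 μ :=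
    (Zc_memLp μ X hX c n).sub (memLp_const _)
  have hWa : MemLp (fun ω => |Zc X c n ω - n * p|) 2 μ := hW.abs
  have h3 := variance_nonneg (fun ω => |Zc X c n ω - n * p|) μ
  rw [variance_eq_sub hWa] at h3
  rw [variance_eq_integral (Zc_measurable X hX c n).aemeasurable, hZint] at hZvar
  simp only [Pi.pow_apply, sq_abs] at h3
  rw [hZvar] at h3
  rw [mul_comm (Real.sqrt _), ← Real.sqrt_mul (Nat.cast_nonneg n)]
  apply Real.le_sqrt_of_sq_le
  linarith

lemma min_max_dev (x y x' y' : ℝ) :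
    |min x (max y 0) - min x' (max y' 0)| ≤ |x - x'| + |y - y'| := by
  refine (abs_min_sub_min_le_max _ _ _ _).trans ?_
  have := abs_max_sub_max_le_abs y y' 0
  refine max_le ?_ ?_
  · linarith [abs_nonneg (y - y')]
  · linarith [abs_nonneg (x - x')]

/-- the key estimate in Lemma 7: with `M = ∑_j √(f_j(1-f_j))`, for every
`0 ≤ k ≤ n` and `j ∈ [m]`, the expectation of the offline-sort count `𝔖_j^n` is within
`M √n` of `min{ n f_j, (k - ∑_{i<j} n f_i)_+ }`; in particular `|E[𝔖_j^n] - s_j^*| ≤ M √n`. -/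
theorem offline_count_near_deterministic {Ω : Type*} [MeasurableSpace Ω] (μ : Measure Ω)
    (m : ℕ) (a f : ℕ → ℝ) (X : ℕ → Ω → ℝ) (hM : ModelX μ m a f X)
    (M : ℝ) (hMdef : M = ∑ j ∈ Icc 1 m, Real.sqrt (f j * (1 - f j)))
    (n k : ℕ) (hkn : k ≤ n) :
    ∀ j, 1 ≤ j → j ≤ m →
      |(∫ ω, Soff a X k n j ω ∂μ) -
          min ((n : ℝ) * f j) (max ((k : ℝ) - ∑ i ∈ Icc 1 (j - 1), (n : ℝ) * f i) 0)|
        ≤ M * Real.sqrt n ∧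
      |(∫ ω, Soff a X k n j ω ∂μ) - sStar f n k j| ≤ M * Real.sqrt n := by
  intro j hj1 hjm
  haveI := hM.hprob
  have hs : sStar f n k j =
      min ((n : ℝ) * f j) (max ((k : ℝ) - ∑ i ∈ Icc 1 (j - 1), (n : ℝ) * f i) 0) := by
    rw [sStar, Fbar, Finset.mul_sum]
  rw [hs, and_self]
  set D := min ((n : ℝ) * f j) (max ((k : ℝ) - ∑ i ∈ Icc 1 (j - 1), (n : ℝ) * f i) 0) with hD
  have hZm := fun i => Zc_measurable X hM.hXmeas (a i) n
  have hdevI : ∀ i, Integrable (fun ω => |Zc X (a i) n ω - n * f i|) μ := fun i =>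
    ((((Zc_memLp μ X hM.hXmeas (a i) n).sub (memLp_const _)).integrable (by norm_num)).abs)
  have hSm : Measurable (fun ω => Soff a X k n j ω) := by
    unfold Soff
    exact (hZm j).min ((measurable_const.sub
      (Finset.measurable_fun_sum _ fun i _ => hZm i)).max measurable_const)
  have hSI : Integrable (fun ω => Soff a X k n j ω) μ := by
    refine Integrable.of_bound hSm.aestronglyMeasurable (n : ℝ) ?_
    refine Filter.Eventually.of_forall fun ω => ?_
    have h0 : 0 ≤ Soff a X k n j ω := le_min (Zc_nonneg _ _ _ _) (le_max_right _ _)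
    rw [Real.norm_eq_abs, abs_of_nonneg h0]
    exact (min_le_left _ _).trans (Zc_le _ _ _ _)
  have hIcc : Icc 1 j = insert j (Icc 1 (j - 1)) := by
    ext i
    simp only [Finset.mem_Icc, Finset.mem_insert]
    omega
  have hnot : j ∉ Icc 1 (j - 1) := by
    simp only [Finset.mem_Icc]
    omega
  have hpt : ∀ ω, |Soff a X k n j ω - D| ≤ ∑ i ∈ Icc 1 j, |Zc X (a i) n ω - n * f i| := by
    intro ω
    rw [hIcc, Finset.sum_insert hnot]
    refine (min_max_dev _ _ _ _).trans ?_
    gcongr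
    rw [show (k : ℝ) - ∑ i ∈ Icc 1 (j - 1), Zc X (a i) n ω -
        ((k : ℝ) - ∑ i ∈ Icc 1 (j - 1), (n : ℝ) * f i) =
        -(∑ i ∈ Icc 1 (j - 1), (Zc X (a i) n ω - n * f i)) by
      rw [Finset.sum_sub_distrib]; ring, abs_neg]
    exact Finset.abs_sum_le_sum_abs _ _
  have h1 : (∫ ω, Soff a X k n j ω ∂μ) - D = ∫ ω, (Soff a X k n j ω - D) ∂μ := by
    rw [integral_sub hSI (integrable_const _)]
    simp
  rw [h1]
  calc |∫ ω, (Soff a X k n j ω - D) ∂μ| ≤ ∫ ω, |Soff a X k n j ω - D| ∂μ :=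
        abs_integral_le_integral_abs
    _ ≤ ∫ ω, ∑ i ∈ Icc 1 j, |Zc X (a i) n ω - n * f i| ∂μ :=
        integral_mono (hSI.sub (integrable_const _)).abs
          (integrable_finsetSum _ fun i _ => hdevI i) hpt
    _ = ∑ i ∈ Icc 1 j, ∫ ω, |Zc X (a i) n ω - n * f i| ∂μ :=
        integral_finsetSum _ fun i _ => hdevI i
    _ ≤ ∑ i ∈ Icc 1 j, Real.sqrt (f i * (1 - f i)) * Real.sqrt n := by
        refine Finset.sum_le_sum fun i hi => ?_
        rw [Finset.mem_Icc] at hi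
        exact Zc_dev μ X hM.hXmeas hM.hIndep (a i) (f i)
          (hM.hf_pos i hi.1 (hi.2.trans hjm)).le
          (fun t => hM.hXdist t i hi.1 (hi.2.trans hjm)) n
    _ ≤ ∑ i ∈ Icc 1 m, Real.sqrt (f i * (1 - f i)) * Real.sqrt n :=
        Finset.sum_le_sum_of_subset_of_nonneg (Finset.Icc_subset_Icc le_rfl hjm)
          (fun i _ _ => by positivity)
    _ = M * Real.sqrt n := by rw [hMdef, Finset.sum_mul]

end MultiSecretary
end
end

section
/- For all 0 ≤ u < n − τ₀, almost surely on the event {τ₀ < n − 2δ^{−1} − 1}: (a) on {K_{τ₀+u} > 0, Y_u ≥ 0}, E[Y_{u+1} − Y_u | 𝓕̂_u] ≤ −(1/2) f_{j(τ₀)}; (b) on {K_{τ₀+u} > 0, Y_u < 0}, E[Y_{u+1} − Y_u | 𝓕̂_u] ≥ (1/2) f_{j(τ₀)}; and (c) on {K_{τ₀+u} = 0}, E[Y_{u+1} − Y_u | 𝓕̂_u] = T_{j(τ₀)}. -/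
open MeasureTheory ProbabilityTheory Finset

noncomputable section

namespace MultiSecretary

variable {Ω : Type*}

/-- The set of abilities selected at time `t` when the remaining budget is `κ`. -/
def selSet (m : ℕ) (a f : ℕ → ℝ) (n t κ : ℕ) : Set ℝ :=
  {x | 0 < κ ∧ (jBR m f ((κ : ℝ) / ((n : ℝ) - t)) = m ∨
    a (jBR m f ((κ : ℝ) / ((n : ℝ) - t)) + 1) < x)}

lemma selSet_meas (m : ℕ) (a f : ℕ → ℝ) (n t κ : ℕ) : MeasurableSet (selSet m a f n t κ) := by
  unfold selSet
  refine MeasurableSet.inter (MeasurableSet.const _) ?_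
  exact MeasurableSet.union (MeasurableSet.const _) measurableSet_Ioi

open Classical in
lemma Kbr_succ (m : ℕ) (a f : ℕ → ℝ) (X : ℕ → Ω → ℝ) (n k t : ℕ) (ω : Ω) :
    Kbr m a f X n k (t + 1) ω = Kbr m a f X n k t ω -
      (if X t ω ∈ selSet m a f n t (Kbr m a f X n k t ω) then 1 else 0) := by
  simp only [Kbr, selSet, Set.mem_ofPred_eq]
  congr

lemma Kbr_succ_real (m : ℕ) (a f : ℕ → ℝ) (X : ℕ → Ω → ℝ) (n k t : ℕ) (ω : Ω) :
    (Kbr m a f X n k (t + 1) ω : ℝ) = (Kbr m a f X n k t ω : ℝ) -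
      (selSet m a f n t (Kbr m a f X n k t ω)).indicator (fun _ => (1 : ℝ)) (X t ω) := by
  classical
  rw [Kbr_succ, Set.indicator_apply]
  split_ifs with h
  · have : 0 < Kbr m a f X n k t ω := h.1
    rw [Nat.cast_sub (by omega)]; simp
  · simp

lemma Fil_mono (X U : ℕ → Ω → ℝ) {s t : ℕ} (h : s ≤ t) : Fil X U s ≤ Fil X U t := by
  unfold Fil
  rw [← measurable_iff_comap_le]
  have : Measurable (fun (g : Fin t → ℝ × ℝ) (i : Fin s) => g (Fin.castLE h i)) := by fun_prop
  exact this.comp (comap_measurable (fun ω => fun s : Fin t => (X s ω, U s ω)))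

lemma Fil_le [MeasurableSpace Ω] (X U : ℕ → Ω → ℝ) (hX : ∀ t, Measurable (X t))
    (hU : ∀ t, Measurable (U t)) (t : ℕ) : Fil X U t ≤ ‹MeasurableSpace Ω› := by
  unfold Fil
  rw [← measurable_iff_comap_le]
  fun_prop

lemma X_Fil (X U : ℕ → Ω → ℝ) (t : ℕ) : Measurable[Fil X U (t + 1)] (X t) := by
  have : Measurable (fun (g : Fin (t + 1) → ℝ × ℝ) => (g (Fin.last t)).1) := by fun_prop
  exact this.comp (comap_measurable (fun ω => fun s : Fin (t + 1) => (X s ω, U s ω)))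

lemma K_Fil (m : ℕ) (a f : ℕ → ℝ) (X U : ℕ → Ω → ℝ) (n k t : ℕ) :
    Measurable[Fil X U t] (Kbr m a f X n k t) := by
  classical
  induction t with
  | zero => exact measurable_const
  | succ t ih =>
    have h1 : Measurable[Fil X U (t + 1)] (Kbr m a f X n k t) :=
      ih.mono (Fil_mono X U (Nat.le_succ t)) le_rfl
    have h2 := X_Fil X U t
    have h3 : Measurable (fun p : ℕ × ℝ =>
        p.1 - (if p.2 ∈ selSet m a f n t p.1 then 1 else 0)) := by
      refine measurable_from_prod_countable_right fun κ => ?_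
      refine Measurable.const_sub ?_ _
      exact Measurable.ite (selSet_meas m a f n t κ) measurable_const measurable_const
    have h4 := h3.comp (h1.prodMk h2)
    convert h4 using 1
    ext ω
    exact Kbr_succ m a f X n k t ω

/-- The defining event of `τ₀` at time `t` as a predicate of the budget. -/
def tauP (m : ℕ) (f : ℕ → ℝ) (δ : ℝ) (n t κ : ℕ) : Prop :=
  (∃ j ∈ Icc 1 m, |(κ : ℝ) / ((n : ℝ) - t) - Tthr f j| ≤ δ / 2) ∨ (n : ℝ) - 2 / δ - 1 ≤ (t : ℝ)

lemma tau0_le (m : ℕ) (f : ℕ → ℝ) (δ : ℝ) (hδ : 0 < δ) (K : ℕ → Ω → ℕ) (n : ℕ) (ω : Ω) :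
    tau0 m f δ K n ω ≤ n := by
  refine Nat.sInf_le (Or.inr ?_)
  have : 0 < 2 / δ := by positivity
  linarith

lemma tau0_spec (m : ℕ) (f : ℕ → ℝ) (δ : ℝ) (hδ : 0 < δ) (K : ℕ → Ω → ℕ) (n : ℕ) (ω : Ω) :
    tauP m f δ n (tau0 m f δ K n ω) (K (tau0 m f δ K n ω) ω) := by
  refine Nat.sInf_mem (s := {t : ℕ |
    (∃ j ∈ Icc 1 m, |ratio K n t ω - Tthr f j| ≤ δ / 2) ∨ (n : ℝ) - 2 / δ - 1 ≤ (t : ℝ)})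
    ⟨n, Or.inr ?_⟩
  have : 0 < 2 / δ := by positivity
  linarith

lemma tau0_eq_iff (m : ℕ) (f : ℕ → ℝ) (δ : ℝ) (hδ : 0 < δ) (K : ℕ → Ω → ℕ) (n t : ℕ) (ω : Ω) :
    tau0 m f δ K n ω = t ↔ tauP m f δ n t (K t ω) ∧ ∀ r < t, ¬ tauP m f δ n r (K r ω) := by
  constructor
  · rintro rfl
    exact ⟨tau0_spec m f δ hδ K n ω, fun r hr h => Nat.notMem_of_lt_sInf hr h⟩
  · rintro ⟨h1, h2⟩
    refine le_antisymm (Nat.sInf_le h1) ?_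
    by_contra! h
    exact h2 _ h (tau0_spec m f δ hδ K n ω)

lemma tau0_Fil (m : ℕ) (a f : ℕ → ℝ) (δ : ℝ) (hδ : 0 < δ) (X U : ℕ → Ω → ℝ) (n k t : ℕ) :
    MeasurableSet[Fil X U t] {ω | tau0 m f δ (Kbr m a f X n k) n ω = t} := by
  have hP : ∀ r ≤ t, MeasurableSet[Fil X U t] {ω | tauP m f δ n r (Kbr m a f X n k r ω)} := by
    intro r hr
    have h1 : Measurable[Fil X U t] (Kbr m a f X n k r) :=
      (K_Fil m a f X U n k r).mono (Fil_mono X U hr) le_rfl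
    exact h1 (MeasurableSet.of_discrete (s := {κ | tauP m f δ n r κ}))
  have : {ω | tau0 m f δ (Kbr m a f X n k) n ω = t} =
      {ω | tauP m f δ n t (Kbr m a f X n k t ω)} ∩
        ⋂ r ∈ Set.Iio t, {ω | tauP m f δ n r (Kbr m a f X n k r ω)}ᶜ := by
    ext ω
    simp [tau0_eq_iff m f δ hδ]
  rw [this]
  refine MeasurableSet.inter (hP t le_rfl) ?_
  refine MeasurableSet.biInter (Set.to_countable _) fun r hr => (hP r (le_of_lt hr)).compl

/-- `j(τ₀)` as a function of `τ₀` and `K_{τ₀}`. -/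
def jfun (m : ℕ) (f : ℕ → ℝ) (δ : ℝ) (n t κ : ℕ) : ℕ :=
  if (t : ℝ) < (n : ℝ) - 2 / δ - 1 then
    sInf {j : ℕ | j ∈ Icc 1 m ∧ |(κ : ℝ) / ((n : ℝ) - t) - Tthr f j| ≤ δ / 2}
  else m + 1

lemma jTau0_eq (m : ℕ) (f : ℕ → ℝ) (δ : ℝ) (K : ℕ → Ω → ℕ) (n : ℕ) (ω : Ω) :
    jTau0 m f δ K n ω = jfun m f δ n (tau0 m f δ K n ω) (K (tau0 m f δ K n ω) ω) := rfl

lemma jTau0_mem (m : ℕ) (f : ℕ → ℝ) (δ : ℝ) (hδ : 0 < δ) (K : ℕ → Ω → ℕ) (n : ℕ) (ω : Ω)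
    (h : (tau0 m f δ K n ω : ℝ) < (n : ℝ) - 2 / δ - 1) :
    1 ≤ jTau0 m f δ K n ω ∧ jTau0 m f δ K n ω ≤ m := by
  unfold jTau0
  rw [if_pos h]
  rcases tau0_spec m f δ hδ K n ω with ⟨j, hj, hj'⟩ | h'
  · have := Nat.sInf_mem (s := {j : ℕ | j ∈ Icc 1 m ∧
      |ratio K n (tau0 m f δ K n ω) ω - Tthr f j| ≤ δ / 2}) ⟨j, hj, hj'⟩
    exact Finset.mem_Icc.1 this.1
  · linarith

lemma jTau0_le (m : ℕ) (f : ℕ → ℝ) (δ : ℝ) (hδ : 0 < δ) (K : ℕ → Ω → ℕ) (n : ℕ) (ω : Ω) :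
    jTau0 m f δ K n ω ≤ m + 1 := by
  by_cases h : (tau0 m f δ K n ω : ℝ) < (n : ℝ) - 2 / δ - 1
  · have := jTau0_mem m f δ hδ K n ω h; omega
  · unfold jTau0; rw [if_neg h]

lemma Fbar_succ (f : ℕ → ℝ) (j : ℕ) (hj : 1 ≤ j) : Fbar f (j + 1) = Fbar f j + f j := by
  unfold Fbar
  obtain ⟨i, rfl⟩ : ∃ i, j = i + 1 := ⟨j - 1, by omega⟩
  simp [Finset.sum_Icc_succ_top]

lemma Fbar_mono (m : ℕ) (f : ℕ → ℝ) (hf : ∀ j, 1 ≤ j → j ≤ m → 0 < f j) {i j : ℕ}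
    (hij : i ≤ j) (hj : j ≤ m + 1) : Fbar f i ≤ Fbar f j := by
  unfold Fbar
  refine Finset.sum_le_sum_of_subset_of_nonneg (Finset.Icc_subset_Icc le_rfl (by omega)) ?_
  intro l hl _
  rw [Finset.mem_Icc] at hl
  exact (hf l hl.1 (by omega)).le

lemma Tthr_mono (m : ℕ) (f : ℕ → ℝ) (hf : ∀ j, 1 ≤ j → j ≤ m → 0 < f j) {i j : ℕ}
    (hi : 1 ≤ i) (hij : i ≤ j) (hj : j ≤ m) : Tthr f i ≤ Tthr f j := by
  unfold Tthr
  have h0 : Fbar f 0 = 0 := by simp [Fbar]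
  have h1 := Fbar_mono m f hf (Nat.zero_le j) (by omega)
  have h2 := Fbar_mono m f hf (Nat.zero_le (j+1)) (by omega)
  have h3 := Fbar_mono m f hf hij (by omega)
  have h4 := Fbar_mono m f hf (Nat.succ_le_succ hij) (by omega)
  simp only [Nat.succ_eq_add_one] at h4
  split_ifs <;> first | omega | linarith

lemma jBR_le (m : ℕ) (f : ℕ → ℝ) (x : ℝ) : jBR m f x ≤ m := by
  unfold jBR
  refine Finset.sup_le fun j hj => ?_
  simp at hj; exact hj.1.2

lemma le_jBR (m : ℕ) (f : ℕ → ℝ) (x : ℝ) (j : ℕ) (h1 : 1 ≤ j) (h2 : j ≤ m) (h : Tthr f j ≤ x) :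
    j ≤ jBR m f x := by
  unfold jBR
  exact Finset.le_sup (f := id) (by simp [*])

lemma jBR_lt (m : ℕ) (f : ℕ → ℝ) (hf : ∀ j, 1 ≤ j → j ≤ m → 0 < f j)
    (x : ℝ) (j : ℕ) (h1 : 1 ≤ j) (h : x < Tthr f j) :
    jBR m f x < j := by
  unfold jBR
  rw [Finset.sup_lt_iff (by simp; omega)]
  intro i hi
  simp at hi
  by_contra! hji
  have := Tthr_mono m f hf h1 hji hi.1.2
  simp at this
  linarith

lemma a_anti (m : ℕ) (a : ℕ → ℝ) (ha : ∀ j, 1 ≤ j → j < m → a (j + 1) < a j) {i j : ℕ}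
    (hi : 1 ≤ i) (hij : i < j) (hj : j ≤ m) : a j < a i := by
  induction j, hij using Nat.le_induction with
  | base => exact ha i hi (by omega)
  | succ j hj' ih => exact (ha j (by simp at hj'; omega) (by omega)).trans (ih (by omega))

section prob
variable [MeasurableSpace Ω] {μ : Measure Ω} {m : ℕ} {a f : ℕ → ℝ} {X U : ℕ → Ω → ℝ}

lemma prob_gt (hM : Model μ m a f X U) (t j : ℕ) (h1 : 1 ≤ j) (hj : j < m) :
    μ.real {ω | a (j + 1) < X t ω} = Fbar f (j + 1) := by
  have := hM.hprob
  have hr : ∀ i, 1 ≤ i → i ≤ m → μ.real {ω | X t ω = a i} = f i := by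
    intro i h1 h2
    rw [measureReal_def, hM.hXdist t i h1 h2, ENNReal.toReal_ofReal (hM.hf_pos i h1 h2).le]
  have hms : ∀ i, MeasurableSet {ω | X t ω = a i} := fun i =>
    hM.hXmeas t (measurableSet_singleton (a i))
  have hU : ∀ S : Finset ℕ, S ⊆ Icc 1 m →
      μ.real (⋃ i ∈ S, {ω | X t ω = a i}) = ∑ i ∈ S, f i := by
    intro S hS
    rw [measureReal_biUnion_finset]
    · refine Finset.sum_congr rfl fun i hi => ?_
      have := Finset.mem_Icc.1 (hS hi)
      exact hr i this.1 this.2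
    · intro i hi i' hi' hne
      refine Set.disjoint_left.2 fun ω h h' => ?_
      simp only [Set.mem_ofPred_eq] at h h'
      have b := Finset.mem_Icc.1 (hS hi)
      have b' := Finset.mem_Icc.1 (hS hi')
      rcases lt_or_gt_of_ne hne with hl | hl
      · have := a_anti m a hM.ha_anti b.1 hl b'.2; linarith
      · have := a_anti m a hM.ha_anti b'.1 hl b.2; linarith
    · intro i _; exact hms i
  have hge : Fbar f (j + 1) ≤ μ.real {ω | a (j + 1) < X t ω} := by
    have := hU (Icc 1 j) (Finset.Icc_subset_Icc le_rfl hj.le)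
    unfold Fbar
    rw [Nat.add_sub_cancel, ← this]
    refine measureReal_mono ?_
    intro ω hω
    simp only [Set.mem_iUnion, Set.mem_ofPred_eq] at hω ⊢
    obtain ⟨i, hi, h⟩ := hω
    rw [Finset.mem_Icc] at hi
    rw [h]
    exact a_anti m a hM.ha_anti hi.1 (by omega) (by omega)
  have hle : μ.real {ω | a (j + 1) < X t ω} + ∑ i ∈ Icc (j + 1) m, f i ≤ 1 := by
    have h := hU (Icc (j+1) m) (Finset.Icc_subset_Icc (by omega) le_rfl)
    rw [← h, ← measureReal_union (h₂ := measure_ne_top _ _)]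
    · exact measureReal_le_one
    · refine Set.disjoint_left.2 fun ω h h' => ?_
      simp only [Set.mem_iUnion, Set.mem_ofPred_eq] at h h'
      obtain ⟨i, hi, h'⟩ := h'
      rw [Finset.mem_Icc] at hi
      rcases Nat.lt_or_ge (j+1) i with hl | hl
      · have := a_anti m a hM.ha_anti (by omega) hl hi.2; linarith
      · have : i = j + 1 := by omega
        subst this; linarith
    · exact Finset.measurableSet_biUnion _ fun i _ => hms i
  have hsum : Fbar f (j + 1) + ∑ i ∈ Icc (j + 1) m, f i = 1 := by
    rw [← hM.hf_sum]
    unfold Fbar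
    rw [Nat.add_sub_cancel, ← Finset.sum_union]
    · congr 1; ext i; simp; omega
    · refine Finset.disjoint_left.2 fun i hi hi' => ?_
      simp at hi hi'; omega
  linarith

lemma prob_sel (hM : Model μ m a f X U) (n t κ : ℕ) (hκ : 0 < κ) (ht : t < n) :
    μ.real (X t ⁻¹' selSet m a f n t κ) =
      Fbar f (jBR m f ((κ : ℝ) / ((n : ℝ) - t)) + 1) := by
  have := hM.hprob
  have hnt : (0 : ℝ) < (n : ℝ) - t := by
    have : (t : ℝ) < n := by exact_mod_cast ht
    linarith
  have h1 : 1 ≤ jBR m f ((κ : ℝ) / ((n : ℝ) - t)) := by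
    refine le_jBR m f _ 1 le_rfl hM.hm ?_
    simp only [Tthr, if_true]
    positivity
  have h2 := jBR_le m f ((κ : ℝ) / ((n : ℝ) - t))
  rcases h2.eq_or_lt with h | h
  · have : X t ⁻¹' selSet m a f n t κ = Set.univ := by
      ext ω; simp [selSet, h, hκ]
    rw [this, h]
    simp [Fbar, hM.hf_sum]
  · rw [← prob_gt hM t _ h1 h]
    congr 1
    ext ω
    simp [selSet, hκ, h.ne]

lemma indep_X (hM : Model μ m a f X U) (t : ℕ) :
    Indep (MeasurableSpace.comap (X t) inferInstance) (Fil X U t) μ := by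
  have h := hM.hIndep.indepFun_finset {t} (range t) (by simp)
    (fun i => (hM.hXmeas i).prodMk (hM.hUmeas i))
  have h' := h.comp (φ := fun g : (({t} : Finset ℕ) → ℝ × ℝ) => (g ⟨t, by simp⟩).1)
    (ψ := fun (g : (range t → ℝ × ℝ)) (i : Fin t) => g ⟨i, by simp⟩)
    (by fun_prop) (by fun_prop)
  exact h'

lemma condExp_congr_on {m' : MeasurableSpace Ω} [IsProbabilityMeasure μ] {E : Set Ω}
    (hE : MeasurableSet[m'] E) {g h : Ω → ℝ} (hg : Integrable g μ) (hh : Integrable h μ)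
    (hgh : ∀ ω ∈ E, g ω = h ω) : ∀ᵐ ω ∂μ, ω ∈ E → (μ[g | m']) ω = (μ[h | m']) ω := by
  have h1 := condExp_indicator hg hE
  have h2 := condExp_indicator hh hE
  have h3 : E.indicator g = E.indicator h := by
    ext ω; by_cases hω : ω ∈ E <;> simp [hω, hgh]
  rw [h3] at h1
  filter_upwards [h1, h2] with ω h1 h2 hω
  rw [h1] at h2
  simpa [hω] using h2

lemma condExp_step (hM : Model μ m a f X U) (t : ℕ) (c : ℝ) {B : Set ℝ} (hB : MeasurableSet B) :
    μ[(fun ω => c - B.indicator (fun _ => (1 : ℝ)) (X t ω)) | Fil X U t] =ᵐ[μ]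
      fun _ => c - μ.real (X t ⁻¹' B) := by
  have := hM.hprob
  have hX := hM.hXmeas t
  have h := condExp_indep_eq (μ := μ)
    (f := fun ω => c - B.indicator (fun _ => (1 : ℝ)) (X t ω)) hX.comap_le
    (Fil_le X U hM.hXmeas hM.hUmeas t) ?_ (indep_X hM t)
  · refine h.trans (Filter.Eventually.of_forall fun _ => ?_)
    have hi : (fun ω => B.indicator (fun _ => (1 : ℝ)) (X t ω)) =
        (X t ⁻¹' B).indicator (fun _ => (1:ℝ)) := rfl
    have hint : Integrable (fun ω => B.indicator (fun _ => (1 : ℝ)) (X t ω)) μ := by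
      rw [hi]
      exact (integrable_const _).indicator (hX hB)
    change ∫ ω, (c - B.indicator (fun _ => (1 : ℝ)) (X t ω)) ∂μ = _
    rw [integral_sub (integrable_const _) hint, hi, integral_indicator_const _ (hX hB)]
    simp
  · refine Measurable.stronglyMeasurable ?_
    have hm : Measurable (fun x : ℝ => c - B.indicator (fun _ => (1 : ℝ)) x) :=
      (measurable_const.indicator hB).const_sub c
    exact hm.comp (comap_measurable (X t))

end prob

/-- the drift conditions (8)–(10) for the Budget-Ratio deviation process:
on the event `{τ₀ < n - 2δ⁻¹ - 1}`, for `0 ≤ u < n - τ₀`, the deviation process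
`Y_u = K_{τ₀+u} - T_{j(τ₀)}(n - τ₀ - u)` has conditional drift (given `𝓕̂_u = 𝓕_{τ₀+u}`)
at most `-f_{j(τ₀)}/2` where `K_{τ₀+u} > 0, Y_u ≥ 0`, at least `f_{j(τ₀)}/2` where
`K_{τ₀+u} > 0, Y_u < 0`, and equal to `T_{j(τ₀)}` where `K_{τ₀+u} = 0`. -/
theorem budget_ratio_drift {Ω : Type*} [MeasurableSpace Ω] (μ : Measure Ω)
    (m : ℕ) (a f : ℕ → ℝ) (X U : ℕ → Ω → ℝ) (hM : Model μ m a f X U)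
    (ε : ℝ) (hε : ε = minf m f / 2) (δ : ℝ) (hδ0 : 0 < δ) (hδε : δ < ε)
    (n k : ℕ) (hkn : k ≤ n)
    (K : ℕ → Ω → ℕ) (hK : K = Kbr m a f X n k)
    (τ₀ : Ω → ℕ) (hτ₀ : τ₀ = tau0 m f δ K n)
    (jτ : Ω → ℕ) (hjτ : jτ = jTau0 m f δ K n)
    (Y : ℕ → Ω → ℝ) (hY : Y = Ydev m f δ K n)
    (mτ : ℕ → MeasurableSpace Ω)
    (hmτ : ∀ (u : ℕ) (s : Set Ω), MeasurableSet[mτ u] s ↔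
      ∀ t : ℕ, MeasurableSet[Fil X U t] (s ∩ {ω | τ₀ ω + u ≤ t})) :
    ∀ u : ℕ, ∀ᵐ ω ∂μ,
      (u + τ₀ ω < n ∧ (τ₀ ω : ℝ) < (n : ℝ) - 2 / δ - 1) →
        ((0 < K (τ₀ ω + u) ω ∧ 0 ≤ Y u ω →
            (μ[(fun ω' => Y (u + 1) ω' - Y u ω') | mτ u]) ω ≤ -(1 / 2) * f (jτ ω)) ∧
          (0 < K (τ₀ ω + u) ω ∧ Y u ω < 0 →
            1 / 2 * f (jτ ω) ≤ (μ[(fun ω' => Y (u + 1) ω' - Y u ω') | mτ u]) ω) ∧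
          (K (τ₀ ω + u) ω = 0 →
            (μ[(fun ω' => Y (u + 1) ω' - Y u ω') | mτ u]) ω = Tthr f (jτ ω))) := by
  subst hK hτ₀ hjτ hY
  intro u
  have := hM.hprob
  set K := Kbr m a f X n k with hKdef
  set τ := tau0 m f δ K n with hτdef
  set J := jTau0 m f δ K n with hJdef
  have hFle := Fil_le X U hM.hXmeas hM.hUmeas
  have hKF : ∀ t, Measurable[Fil X U t] (K t) := K_Fil m a f X U n k
  have hτF : ∀ t, MeasurableSet[Fil X U t] {ω | τ ω = t} := tau0_Fil m a f δ hδ0 X U n k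
  have hτle : ∀ ω, τ ω ≤ n := tau0_le m f δ hδ0 K n
  have hτm : Measurable τ := measurable_to_countable' fun t => hFle t _ (hτF t)
  have hKm : ∀ t, Measurable (K t) := fun t => (hKF t).mono (hFle t) le_rfl
  have hKu : Measurable (fun p : ℕ × Ω => K p.1 p.2) := measurable_from_prod_countable_right hKm
  have hKτ : ∀ v, Measurable (fun ω => K (τ ω + v) ω) := fun v =>
    hKu.comp ((hτm.add_const v).prodMk measurable_id)
  have hJm : Measurable J := by
    have h1 : Measurable (fun p : ℕ × ℕ => jfun m f δ n p.1 p.2) := Measurable.of_discrete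
    exact h1.comp (hτm.prodMk (hKτ 0))
  set D : Ω → ℝ := fun ω' => Ydev m f δ K n (u + 1) ω' - Ydev m f δ K n u ω' with hD
  have hDeq : ∀ ω, D ω = Tthr f (J ω) -
      (selSet m a f n (τ ω + u) (K (τ ω + u) ω)).indicator (fun _ => (1 : ℝ)) (X (τ ω + u) ω) := by
    intro ω
    have := Kbr_succ_real m a f X n k (τ ω + u) ω
    simp only [hD, Ydev]
    rw [← hτdef, ← hJdef, ← add_assoc]
    rw [← hKdef] at this
    rw [this]
    push_cast
    ring
  have hDm : Measurable D := by
    have h1 : ∀ v, Measurable (Ydev m f δ K n v) := by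
      intro v
      unfold Ydev
      have hT : Measurable (Tthr f) := Measurable.of_discrete
      have hc : Measurable (fun x : ℕ => (x : ℝ)) := Measurable.of_discrete
      exact (hc.comp (hKτ v)).sub ((hT.comp hJm).mul
        (((hc.comp hτm).const_sub _).sub_const _))
    exact (h1 _).sub (h1 _)
  have hDint : Integrable D μ := by
    refine Integrable.of_bound hDm.aestronglyMeasurable
      ((∑ j ∈ range (m + 2), |Tthr f j|) + 1) (Filter.Eventually.of_forall fun ω => ?_)
    rw [hDeq, Real.norm_eq_abs]
    refine (abs_sub _ _).trans (add_le_add ?_ ?_)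
    · have : J ω ≤ m + 1 := jTau0_le m f δ hδ0 K n ω
      exact Finset.single_le_sum (f := fun j => |Tthr f j|) (fun _ _ => abs_nonneg _)
        (Finset.mem_range.2 (by omega))
    · classical
      rw [Set.indicator_apply]; split_ifs <;> simp
  have hmle : mτ u ≤ ‹MeasurableSpace Ω› := by
    intro s hs
    have := (hmτ u s).1 hs (n + u)
    have h2 : s ∩ {ω | τ ω + u ≤ n + u} = s := by
      ext ω; simp [hτle ω]
    rw [h2] at this
    exact hFle _ _ this
  have hsF : ∀ t, MeasurableSet[Fil X U t] {ω | τ ω + u = t} := by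
    intro t
    by_cases h : u ≤ t
    · have : {ω | τ ω + u = t} = {ω | τ ω = t - u} := by ext ω; simp; omega
      rw [this]
      exact Fil_mono X U (Nat.sub_le t u) _ (hτF _)
    · have : {ω | τ ω + u = t} = ∅ := by ext ω; simp; omega
      rw [this]; exact @MeasurableSet.empty _ (_)
  have hloc : ∀ t A, MeasurableSet[mτ u] ({ω | τ ω + u = t} ∩ A) ↔
      MeasurableSet[Fil X U t] ({ω | τ ω + u = t} ∩ A) := by
    intro t A
    rw [hmτ]
    constructor
    · intro h
      have h1 := h t
      have : {ω | τ ω + u = t} ∩ A ∩ {ω | τ ω + u ≤ t} = {ω | τ ω + u = t} ∩ A := by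
        ext ω; simp; intro h _; omega
      rwa [this] at h1
    · intro h r
      by_cases hr : t ≤ r
      · have : {ω | τ ω + u = t} ∩ A ∩ {ω | τ ω + u ≤ r} = {ω | τ ω + u = t} ∩ A := by
          ext ω; simp; intro h _; omega
        rw [this]
        exact Fil_mono X U hr _ h
      · have : {ω | τ ω + u = t} ∩ A ∩ {ω | τ ω + u ≤ r} = ∅ := by
          ext ω; simp; intro h _; omega
        rw [this]; exact @MeasurableSet.empty _ (_)
  have hA : ∀ t, ∀ᵐ ω ∂μ, τ ω + u = t → (μ[D | mτ u]) ω = (μ[D | Fil X U t]) ω := by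
    intro t
    have hs : MeasurableSet[mτ u] {ω | τ ω + u = t} := by
      have := (hloc t Set.univ).2
      simp only [Set.inter_univ] at this
      exact this (hsF t)
    have h := condExp_ae_eq_restrict_of_measurableSpace_eq_on (μ := μ) (f := D) hmle (hFle t)
      hs (hloc t)
    exact (ae_restrict_iff' (hmle _ hs)).1 h
  have hB : ∀ t κ j, ∀ᵐ ω ∂μ, (τ ω + u = t ∧ K t ω = κ ∧ J ω = j) →
      (μ[D | Fil X U t]) ω = Tthr f j - μ.real (X t ⁻¹' selSet m a f n t κ) := by
    intro t κ j
    have hE : MeasurableSet[Fil X U t] {ω | τ ω + u = t ∧ K t ω = κ ∧ J ω = j} := by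
      by_cases hut : u ≤ t
      · have : {ω | τ ω + u = t ∧ K t ω = κ ∧ J ω = j} =
            {ω | τ ω + u = t} ∩ ((K t ⁻¹' {κ}) ∩
              K (t - u) ⁻¹' {x | jfun m f δ n (t - u) x = j}) := by
          ext ω
          simp only [Set.mem_ofPred_eq, Set.mem_inter_iff, Set.mem_preimage,
            Set.mem_singleton_iff]
          refine and_congr_right fun h => and_congr_right fun _ => ?_
          have h' : τ ω = t - u := by omega
          rw [hJdef, jTau0_eq, ← hτdef, h']
        rw [this]
        refine (hsF t).inter (((hKF t) (measurableSet_singleton κ)).inter ?_)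
        exact Fil_mono X U (Nat.sub_le t u) _ ((hKF (t - u)) MeasurableSet.of_discrete)
      · have : {ω | τ ω + u = t ∧ K t ω = κ ∧ J ω = j} = ∅ := by
          ext ω; simp; intro h; omega
        rw [this]; exact @MeasurableSet.empty _ (_)
    have hBm := selSet_meas m a f n t κ
    have hint : Integrable (fun ω => Tthr f j -
        (selSet m a f n t κ).indicator (fun _ => (1 : ℝ)) (X t ω)) μ :=
      (integrable_const _).sub
        ((integrable_const (1 : ℝ)).indicator (hM.hXmeas t hBm))
    have h1 := condExp_congr_on (μ := μ) hE hDint hint (by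
      rintro ω ⟨rfl, rfl, rfl⟩
      exact hDeq ω)
    filter_upwards [h1, condExp_step hM t (Tthr f j) hBm] with ω h1 h2 hω
    rw [h1 hω, h2]
  have hA' := ae_all_iff.2 hA
  have hB' : ∀ᵐ ω ∂μ, ∀ t κ j, (τ ω + u = t ∧ K t ω = κ ∧ J ω = j) →
      (μ[D | Fil X U t]) ω = Tthr f j - μ.real (X t ⁻¹' selSet m a f n t κ) := by
    simp only [ae_all_iff]
    exact hB
  filter_upwards [hA', hB'] with ω hA hB
  rintro ⟨hun, hτn⟩
  have hc : (μ[D | mτ u]) ω = Tthr f (J ω) -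
      μ.real (X (τ ω + u) ⁻¹' selSet m a f n (τ ω + u) (K (τ ω + u) ω)) := by
    rw [hA _ rfl, hB _ _ _ ⟨rfl, rfl, rfl⟩]
  rw [hc]
  obtain ⟨hJ1, hJm'⟩ : 1 ≤ J ω ∧ J ω ≤ m := jTau0_mem m f δ hδ0 K n ω hτn
  have hnt : (0 : ℝ) < (n : ℝ) - ((τ ω + u : ℕ) : ℝ) := by
    have : ((τ ω + u : ℕ) : ℝ) < n := by exact_mod_cast (by omega : τ ω + u < n)
    linarith
  have hYe : Ydev m f δ K n u ω = (K (τ ω + u) ω : ℝ) -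
      Tthr f (J ω) * ((n : ℝ) - ((τ ω + u : ℕ) : ℝ)) := by
    simp only [Ydev]; rw [← hτdef, ← hJdef]; push_cast; ring
  have hfp := hM.hf_pos
  have hFs := Fbar_succ f (J ω) hJ1
  have hfJ := hfp (J ω) hJ1 hJm'
  refine ⟨?_, ?_, ?_⟩
  · rintro ⟨hKpos, hY0⟩
    rw [prob_sel hM n (τ ω + u) _ hKpos (by omega)]
    have hr : Tthr f (J ω) ≤ (K (τ ω + u) ω : ℝ) / ((n : ℝ) - ((τ ω + u : ℕ) : ℝ)) := by
      rw [le_div_iff₀ hnt]; linarith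
    have h1 := le_jBR m f _ (J ω) hJ1 hJm' hr
    have h2 := jBR_le m f ((K (τ ω + u) ω : ℝ) / ((n : ℝ) - ((τ ω + u : ℕ) : ℝ)))
    have h3 := Fbar_mono m f hfp (Nat.add_le_add_right h1 1) (by omega)
    have h4 := Fbar_mono m f hfp (Nat.zero_le (J ω)) (by omega)
    have h0 : Fbar f 0 = 0 := by simp [Fbar]
    have hT : Tthr f (J ω) ≤ (Fbar f (J ω) + Fbar f (J ω + 1)) / 2 := by
      unfold Tthr; split_ifs <;> linarith
    linarith
  · rintro ⟨hKpos, hY0⟩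
    rw [prob_sel hM n (τ ω + u) _ hKpos (by omega)]
    have hr : (K (τ ω + u) ω : ℝ) / ((n : ℝ) - ((τ ω + u : ℕ) : ℝ)) < Tthr f (J ω) := by
      rw [div_lt_iff₀ hnt]; linarith
    have h1 := jBR_lt m f hfp _ (J ω) hJ1 hr
    have h3 := Fbar_mono m f hfp (Nat.succ_le_of_lt h1) (by omega)
    simp only [Nat.succ_eq_add_one] at h3
    have hJne : J ω ≠ 1 := by
      intro h
      rw [h] at hr
      simp only [Tthr, if_true] at hr
      have : (0 : ℝ) ≤ (K (τ ω + u) ω : ℝ) / ((n : ℝ) - ((τ ω + u : ℕ) : ℝ)) := by positivity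
      linarith
    have hT : Tthr f (J ω) = (Fbar f (J ω) + Fbar f (J ω + 1)) / 2 := by
      unfold Tthr; rw [if_neg hJne]
    linarith
  · intro hK0
    have : X (τ ω + u) ⁻¹' selSet m a f n (τ ω + u) (K (τ ω + u) ω) = ∅ := by
      ext ω'; simp [selSet, hK0]
    rw [this]; simp

end MultiSecretary
end
end
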